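/- arXiv:1411.0290 — 3 statements merged into one kernel-verified Lean document; each statement's English description precedes it below -/
import Mathlib

section
/- If G is a connected finite simple graph with at least two vertices and G ∈ N_c, then W_c(G) ≤ 2|V(G)| + Δ(G) − 4, where Δ(G) is the maximum degree of G. Moreover, if G has at least three vertices, then W_c(G) ≤ 2|V(G)| + Δ(G) − 5. -/
attribute [local instance] Classical.propDecidable

namespace IntervalCyclic

variable {V : Type*}

/-- An interval cyclic `t`-coloring: a proper edge-coloring with colors viewed as
elements of `ZMod t` (representing the colors `1,…,t` cyclically) such that all `t`
colors are used and, at every vertex `v`, the set of colors on the edges incident to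
`v` is a set of `d_G(v)` consecutive colors modulo `t`. -/
def IsIntervalCyclicColoring [Fintype V] (G : SimpleGraph V) (t : ℕ)
    (c : Sym2 V → ZMod t) : Prop :=
  (∀ v w w' : V, G.Adj v w → G.Adj v w' → w ≠ w' → c s(v, w) ≠ c s(v, w')) ∧
  (∀ x : ZMod t, ∃ e ∈ G.edgeSet, c e = x) ∧
  (∀ v : V, ∃ k : ZMod t,
    (G.neighborFinset v).image (fun w => c s(v, w)) =
      (Finset.range (G.degree v)).image (fun i => k + (i : ZMod t)))

/-- `G` has an interval cyclic `t`-coloring for the positive integer `t`. -/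
def HasIntervalCyclicColoring [Fintype V] (G : SimpleGraph V) (t : ℕ) : Prop :=
  0 < t ∧ ∃ c : Sym2 V → ZMod t, IsIntervalCyclicColoring G t c

/-- The greatest `t` for which `G` has an interval cyclic `t`-coloring. -/
noncomputable def Wc [Fintype V] (G : SimpleGraph V) : ℕ :=
  sSup {t | HasIntervalCyclicColoring G t}

/-- The least `t` for which `G` has an interval cyclic `t`-coloring. -/
noncomputable def wc [Fintype V] (G : SimpleGraph V) : ℕ :=
  sInf {t | HasIntervalCyclicColoring G t}

/-- An integer-labelled cover of a set `V` of vertices: every point `p` of the cover lies over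
`proj p`, its incident edges carry exactly the labels `lo p, …, hi p`, and two points over the
same vertex are equal as soon as they carry labels at distance at most `L`. -/
structure LabelledCover (P V : Type*) (L : ℤ) where
  proj : P → V
  lo : P → ℤ
  hi : P → ℤ
  edge : P → P → ℤ → Prop
  edge_symm : ∀ {p q x}, edge p q x → edge q p x
  edge_irrefl : ∀ {p x}, ¬ edge p p x
  lo_le : ∀ {p q x}, edge p q x → lo p ≤ x
  le_hi : ∀ {p q x}, edge p q x → x ≤ hi p
  exists_edge : ∀ {p x}, lo p ≤ x → x ≤ hi p → ∃ q, edge p q x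
  label_unique : ∀ {p q x y}, edge p q x → edge p q y → x = y
  lift_unique : ∀ {p q x y}, proj p = proj q → lo p ≤ x → x ≤ hi p → lo q ≤ y → y ≤ hi q →
    |x - y| ≤ L → p = q

namespace LabelledCover

variable {P : Type*} {L : ℤ} (C : LabelledCover P V L)

/-- `C.Reach a m p` says that some walk with `m` edges leads to `p` from a point whose least
label is at most `a`. -/
def Reach (a : ℤ) : ℕ → P → Prop
  | 0, p => C.lo p ≤ a
  | m + 1, p => ∃ q x, Reach a m q ∧ C.edge q p x

/-- A walk `p 0, …, p m` from a point whose least label is at most `a`, in which the label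
`c (j + 1)` of the edge entering `p (j + 1)` is as large as it can be for a walk with `j + 1`
edges to `p (j + 1)`. -/
structure IsGreedy (a : ℤ) (m : ℕ) (p : ℕ → P) (c : ℕ → ℤ) : Prop where
  start : C.lo (p 0) ≤ a
  edge : ∀ j < m, C.edge (p j) (p (j + 1)) (c (j + 1))
  max : ∀ j < m, ∀ q y, C.Reach a j q → C.edge q (p (j + 1)) y → y ≤ c (j + 1)

theorem Reach.exists_isGreedy {C : LabelledCover P V L} {a : ℤ} {m : ℕ} {q : P}
    (h : C.Reach a m q) : ∃ p c, C.IsGreedy a m p c ∧ p m = q := by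
  induction m generalizing q with
  | zero => exact ⟨fun _ => q, fun _ => 0, ⟨h, by simp, by simp⟩, rfl⟩
  | succ m ih =>
    obtain ⟨r₀, x₀, hr₀, hx₀⟩ := h
    obtain ⟨x, ⟨r, hr, hx⟩, hmax⟩ := Int.exists_greatest_of_bdd
      (P := fun y => ∃ r, C.Reach a m r ∧ C.edge r q y)
      ⟨C.hi q, fun y ⟨r, _, hy⟩ => C.le_hi (C.edge_symm hy)⟩ ⟨x₀, r₀, hr₀, hx₀⟩
    obtain ⟨p, c, hg, rfl⟩ := ih hr
    refine ⟨Function.update p (m + 1) q, Function.update c (m + 1) x, ⟨?_, ?_, ?_⟩, by simp⟩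
    · simpa using hg.start
    · intro j hj
      rcases Nat.lt_succ_iff_lt_or_eq.1 hj with hj | rfl
      · rw [Function.update_of_ne (by omega), Function.update_of_ne (by omega),
          Function.update_of_ne (by omega)]
        exact hg.edge j hj
      · simpa using hx
    · intro j hj r' y hr' hy
      rcases Nat.lt_succ_iff_lt_or_eq.1 hj with hj | rfl
      · rw [Function.update_of_ne (by omega)] at hy ⊢
        exact hg.max j hj r' y hr' hy
      · simp only [Function.update_self] at hy ⊢
        exact hmax y ⟨r', hr', hy⟩

namespace IsGreedy

variable {C} {a : ℤ} {m : ℕ} {p : ℕ → P} {c : ℕ → ℤ}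

theorem reach (hg : C.IsGreedy a m p c) : ∀ j ≤ m, C.Reach a j (p j)
  | 0, _ => hg.start
  | j + 1, hj => ⟨p j, c (j + 1), hg.reach j (by omega), hg.edge j (by omega)⟩

theorem reach_add (hg : C.IsGreedy a m p c) {i j : ℕ} (h : C.Reach a i (p j)) :
    ∀ s, j + s ≤ m → C.Reach a (i + s) (p (j + s))
  | 0, _ => h
  | s + 1, hs => ⟨_, _, hg.reach_add h s (by omega), hg.edge (j + s) (by omega)⟩

/-- The walk is shortest: no point of it can be reached in fewer steps. -/
theorem le_of_reach (hg : C.IsGreedy a m p c)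
    (hmin : ∀ i < m, ∀ q, C.Reach a i q → C.hi q < a + L) (hend : a + L ≤ C.hi (p m))
    {i j : ℕ} (hj : j ≤ m) (h : C.Reach a i (p j)) : j ≤ i := by
  by_contra! hij
  have := hg.reach_add h (m - j) (by omega)
  rw [show j + (m - j) = m by omega] at this
  have := hmin _ (by omega) _ this
  omega

theorem lt_label (hg : C.IsGreedy a m p c)
    (hmin : ∀ i < m, ∀ q, C.Reach a i q → C.hi q < a + L) (hend : a + L ≤ C.hi (p m))
    {j : ℕ} (hj : j < m) : a < c (j + 1) := by
  by_contra! h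
  have h1 : C.Reach a 0 (p (j + 1)) := (C.lo_le (C.edge_symm (hg.edge j hj))).trans h
  have := hg.le_of_reach hmin hend hj h1
  omega

theorem label_lt (hg : C.IsGreedy a m p c)
    (hmin : ∀ i < m, ∀ q, C.Reach a i q → C.hi q < a + L)
    {j : ℕ} (hj : j < m) : c (j + 1) < a + L :=
  (C.le_hi (hg.edge j hj)).trans_lt (hmin j hj _ (hg.reach j hj.le))

/-- Every point of the walk carries a label strictly between `a` and `a + L`. -/
theorem exists_label (hg : C.IsGreedy a m p c)
    (hmin : ∀ i < m, ∀ q, C.Reach a i q → C.hi q < a + L) (hend : a + L ≤ C.hi (p m))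
    (hm : 0 < m) {j : ℕ} (hj : j ≤ m) :
    ∃ y, C.lo (p j) ≤ y ∧ y ≤ C.hi (p j) ∧ a < y ∧ y < a + L := by
  cases j with
  | zero =>
    have h := hg.edge 0 hm
    exact ⟨c 1, C.lo_le h, C.le_hi h, hg.lt_label hmin hend hm, hg.label_lt hmin hm⟩
  | succ j =>
    have h := C.edge_symm (hg.edge j hj)
    exact ⟨c (j + 1), C.lo_le h, C.le_hi h, hg.lt_label hmin hend hj, hg.label_lt hmin hj⟩

/-- Every label in the window `(a, a + L]` occurs at some point `p i` of the walk which was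
entered by a smaller label. -/
theorem exists_index (hg : C.IsGreedy a m p c) (hend : a + L ≤ C.hi (p m)) {x : ℤ}
    (hax : a < x) (hxL : x ≤ a + L) :
    ∃ i w, i ≤ m ∧ (∀ j, i = j + 1 → c i < x) ∧ C.edge (p i) w x ∨ ∃ j < m, x = c (j + 1) := by
  by_cases hx : ∃ j < m, x = c (j + 1)
  · exact ⟨0, p 0, Or.inr hx⟩
  push Not at hx
  let S : ℕ → Prop := fun i => i = 0 ∨ c i < x
  have hS : S (Nat.findGreatest S m) := Nat.findGreatest_spec (Nat.zero_le m) (Or.inl rfl)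
  have hle : Nat.findGreatest S m ≤ m := Nat.findGreatest_le m
  have hgr : ∀ k, Nat.findGreatest S m < k → k ≤ m → ¬ S k :=
    fun k => Nat.findGreatest_is_greatest
  generalize Nat.findGreatest S m = i at hS hle hgr
  have hlo : C.lo (p i) ≤ x := by
    cases i with
    | zero => exact hg.start.trans hax.le
    | succ i =>
      have := C.lo_le (C.edge_symm (hg.edge i hle))
      have : c (i + 1) < x := by simpa [S] using hS
      omega
  have hhi : x ≤ C.hi (p i) := by
    rcases hle.eq_or_lt with rfl | hlt
    · omega
    · have h1 := C.le_hi (hg.edge i hlt)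
      have h2 := hgr (i + 1) (by omega) hlt
      simp only [S, not_or, not_lt] at h2
      omega
  obtain ⟨w, hw⟩ := C.exists_edge hlo hhi
  refine ⟨i, w, Or.inl ⟨hle, ?_, hw⟩⟩
  rintro j rfl
  simpa [S] using hS

end IsGreedy

theorem abs_sub_le_of_mem {a x y : ℤ} (hx : a ≤ x) (hx' : x ≤ a + L) (hy : a ≤ y)
    (hy' : y ≤ a + L) : |x - y| ≤ L :=
  abs_le.2 ⟨by omega, by omega⟩

theorem IsGreedy.add_le [Fintype V] {C : LabelledCover P V L} {a : ℤ} {m : ℕ} {p : ℕ → P}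
    {c : ℕ → ℤ} (hg : C.IsGreedy a m p c)
    (hmin : ∀ i < m, ∀ q, C.Reach a i q → C.hi q < a + L) (hend : a + L ≤ C.hi (p m))
    (hm : 0 < m) : L + m + 4 ≤ 2 * Fintype.card V := by
  have hsp : ∀ {i j : ℕ}, j ≤ m → C.Reach a i (p j) → j ≤ i := hg.le_of_reach hmin hend
  have hc1 := hg.lt_label hmin hend hm
  have hc1' := hg.label_lt hmin hm
  obtain ⟨z, hz⟩ : ∃ z, C.edge (p 0) z a :=
    C.exists_edge hg.start (by have := C.le_hi (hg.edge 0 hm); omega)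
  have hz' := C.edge_symm hz
  have hz0 : C.Reach a 0 z := C.lo_le hz'
  -- the points of the walk, together with `z`, lie over distinct vertices
  let o : Option (Fin (m + 1)) → V := fun j => C.proj (j.elim z fun j => p j)
  have ho_inj : Function.Injective o := by
    have key : ∀ i j : ℕ, i ≤ m → j ≤ m → C.proj (p i) = C.proj (p j) → j ≤ i := by
      intro i j hi hj hij
      obtain ⟨x, h1, h2, h3, h4⟩ := hg.exists_label hmin hend hm hi
      obtain ⟨y, h5, h6, h7, h8⟩ := hg.exists_label hmin hend hm hj
      have e := C.lift_unique hij h1 h2 h5 h6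
        (abs_sub_le_of_mem h3.le h4.le h7.le h8.le)
      exact hsp hj (e ▸ hg.reach i hi)
    have key' : ∀ j : ℕ, j ≤ m → C.proj z ≠ C.proj (p j) := by
      intro j hj hij
      obtain ⟨y, h5, h6, h7, h8⟩ := hg.exists_label hmin hend hm hj
      have e := C.lift_unique hij (C.lo_le hz') (C.le_hi hz') h5 h6
        (abs_sub_le_of_mem le_rfl (by omega) h7.le h8.le)
      have : j ≤ 0 := hsp hj (e ▸ hz0)
      obtain rfl : j = 0 := by omega
      exact C.edge_irrefl (e ▸ hz)
    rintro (_ | i) (_ | j) h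
    · rfl
    · exact absurd h (key' j (by omega))
    · exact absurd h.symm (key' i (by omega))
    · have h1 := key i j (by omega) (by omega) h
      have h2 := key j i (by omega) (by omega) h.symm
      congr 1
      exact Fin.ext (le_antisymm h2 h1)
  let X : Finset ℤ := Finset.Ioc a (a + L) \ (Finset.range m).image fun j => c (j + 1)
  have hX : ∀ x ∈ X, a < x ∧ x ≤ a + L ∧ ∀ j < m, x ≠ c (j + 1) := by
    intro x hx
    simp only [X, Finset.mem_sdiff, Finset.mem_Ioc, Finset.mem_image, Finset.mem_range,
      not_exists, not_and] at hx
    exact ⟨hx.1.1, hx.1.2, fun j hj h => hx.2 j hj h.symm⟩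
  have hXcard : L ≤ X.card + m := by
    have h1 := Finset.le_card_sdiff ((Finset.range m).image fun j => c (j + 1))
      (Finset.Ioc a (a + L))
    have h2 : ((Finset.range m).image fun j => c (j + 1)).card ≤ m :=
      Finset.card_image_le.trans (by simp)
    rw [Int.card_Ioc] at h1
    change _ ≤ X.card at h1
    omega
  have hex : ∀ x ∈ X, ∃ i w, i ≤ m ∧ (∀ j, i = j + 1 → c i < x) ∧ C.edge (p i) w x := by
    intro x hx
    obtain ⟨h1, h2, h3⟩ := hX x hx
    obtain ⟨i, w, h | ⟨j, hj, h⟩⟩ := hg.exists_index hend h1 h2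
    · exact ⟨i, w, h⟩
    · exact absurd h (h3 j hj)
  have : Nonempty P := ⟨z⟩
  choose! I W hIm hIc hIW using hex
  let U : Finset V := Finset.univ \ Finset.univ.image o
  have hU : U.card + (m + 2) = Fintype.card V := by
    have h1 : (Finset.univ.image o).card = m + 2 := by
      rw [Finset.card_image_of_injective _ ho_inj]; simp
    have h2 := Finset.card_sdiff_add_card_eq_card (Finset.subset_univ (Finset.univ.image o))
    rw [h1] at h2
    exact h2
  have hmaps : ∀ x ∈ X, (C.proj (W x), I x % 2) ∈ U ×ˢ Finset.range 2 := by
    intro x hx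
    obtain ⟨h1, h2, h3⟩ := hX x hx
    have hi := hIm x hx
    have hW := hIW x hx
    have hW' := C.edge_symm hW
    simp only [U, Finset.mem_product, Finset.mem_sdiff, Finset.mem_univ, true_and,
      Finset.mem_image, not_exists, Finset.mem_range]
    refine ⟨?_, Nat.mod_lt _ two_pos⟩
    rintro (_ | j) hj
    · have e : z = W x := C.lift_unique hj (C.lo_le hz') (C.le_hi hz') (C.lo_le hW')
        (C.le_hi hW') (abs_sub_le_of_mem le_rfl (by omega) h1.le h2)
      rw [← e] at hW hW'
      have hI : I x ≤ 1 := hsp hi ⟨z, x, hz0, hW'⟩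
      rcases Nat.le_one_iff_eq_zero_or_eq_one.1 hI with h0 | h0
      · rw [h0] at hW
        have := C.label_unique hW hz
        omega
      · have h4 := hIc x hx 0 h0
        rw [h0] at hW' h4
        have := hg.max 0 hm z x hz0 hW'
        simp only [zero_add] at this
        omega
    · have hjm : (j : ℕ) ≤ m := by omega
      obtain ⟨y, h5, h6, h7, h8⟩ := hg.exists_label hmin hend hm hjm
      have e : p j = W x := C.lift_unique hj h5 h6 (C.lo_le hW') (C.le_hi hW')
        (abs_sub_le_of_mem h7.le h8.le h1.le h2)
      rw [← e] at hW hW'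
      have h9 : (j : ℕ) ≤ I x + 1 := hsp hjm ⟨_, x, hg.reach _ hi, hW⟩
      have h10 : I x ≤ (j : ℕ) + 1 := hsp hi ⟨_, x, hg.reach _ hjm, hW'⟩
      rcases lt_trichotomy (I x) (j : ℕ) with h | h | h
      · obtain h : (j : ℕ) = I x + 1 := by omega
        rw [h] at hW
        exact h3 (I x) (by omega) (C.label_unique hW (hg.edge (I x) (by omega)))
      · rw [h] at hW
        exact C.edge_irrefl hW
      · obtain h : I x = (j : ℕ) + 1 := by omega
        rw [h] at hW'
        exact h3 j (by omega) (C.label_unique hW' (hg.edge j (by omega)))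
  have hinj : Set.InjOn (fun x => (C.proj (W x), I x % 2)) (X : Set ℤ) := by
    have key : ∀ x ∈ X, ∀ y ∈ X, C.proj (W x) = C.proj (W y) → I x % 2 = I y % 2 →
        I x ≤ I y → x = y := by
      intro x hx y hy hw hpar hle
      obtain ⟨hx1, hx2, -⟩ := hX x hx
      obtain ⟨hy1, hy2, -⟩ := hX y hy
      have hWx := hIW x hx
      have hWy := C.edge_symm (hIW y hy)
      have hWx' := C.edge_symm hWx
      have e : W x = W y := C.lift_unique hw (C.lo_le hWx') (C.le_hi hWx') (C.lo_le hWy)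
        (C.le_hi hWy) (abs_sub_le_of_mem hx1.le hx2 hy1.le hy2)
      rcases hle.eq_or_lt with h | h
      · rw [e, h] at hWx
        exact C.label_unique hWx (hIW y hy)
      · exfalso
        rw [← e] at hWy
        have hr : C.Reach a (I x + 1) (W x) := ⟨_, x, hg.reach _ (hIm x hx), hWx⟩
        have h1 : I y ≤ I x + 1 + 1 := hsp (hIm y hy) ⟨_, y, hr, hWy⟩
        have h2 : I y = I x + 1 + 1 := by omega
        have h3 := hIc y hy _ h2
        have h4 := hIm y hy
        rw [h2] at hWy h3 h4
        have := hg.max (I x + 1) (by omega) _ y hr hWy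
        omega
    intro x hx y hy hxy
    simp only [Prod.mk.injEq] at hxy
    rcases le_total (I x) (I y) with h | h
    · exact key x hx y hy hxy.1 hxy.2 h
    · exact (key y hy x hx hxy.1.symm hxy.2.symm h).symm
  have := Finset.card_le_card_of_injOn _ hmaps hinj
  rw [Finset.card_product, Finset.card_range] at this
  omega

/-- If some walk climbs by at least `L`, then `L` is small. -/
theorem le_of_reach [Fintype V] (hdeg : ∀ p, C.hi p - C.lo p + 2 ≤ Fintype.card V)
    (h : ∃ a m p, C.Reach a m p ∧ a + L ≤ C.hi p) :
    L + 2 ≤ Fintype.card V ∨ L + 5 ≤ 2 * Fintype.card V := by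
  have h' : ∃ m a p, C.Reach a m p ∧ a + L ≤ C.hi p := by
    obtain ⟨a, m, p, h⟩ := h
    exact ⟨m, a, p, h⟩
  obtain ⟨a, q, hr, hq⟩ := Nat.find_spec h'
  have hmin : ∀ i < Nat.find h', ∀ q, C.Reach a i q → C.hi q < a + L := by
    intro i hi q hq
    by_contra! hcon
    exact Nat.find_min h' hi ⟨a, q, hq, hcon⟩
  generalize Nat.find h' = m at hr hmin
  rcases Nat.eq_zero_or_pos m with rfl | hm
  · left
    have h1 : C.lo q ≤ a := hr
    have := hdeg q
    omega
  · right
    obtain ⟨p, c, hg, rfl⟩ := hr.exists_isGreedy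
    have := hg.add_le hmin hq hm
    omega

end LabelledCover

section Lift

variable [Fintype V] {G : SimpleGraph V} {t : ℕ}

theorem IsIntervalCyclicColoring.degree_le {c : Sym2 V → ZMod t} (ht : 0 < t)
    (hc : IsIntervalCyclicColoring G t c) (v : V) : G.degree v ≤ t := by
  have : NeZero t := ⟨ht.ne'⟩
  have hinj : Set.InjOn (fun w => c s(v, w)) (G.neighborFinset v : Set V) := by
    intro w hw w' hw' h
    by_contra hne
    exact hc.1 v w w' (by simpa using hw) (by simpa using hw') hne h
  have h := Finset.card_le_univ ((G.neighborFinset v).image fun w => c s(v, w))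
  rwa [Finset.card_image_of_injOn hinj, G.card_neighborFinset_eq_degree, ZMod.card] at h

theorem IsIntervalCyclicColoring.exists_start {c : Sym2 V → ZMod t}
    (hc : IsIntervalCyclicColoring G t c) : ∃ k : V → ZMod t, ∀ v,
      (G.neighborFinset v).image (fun w => c s(v, w)) =
        (Finset.range (G.degree v)).image (fun i : ℕ => k v + (i : ZMod t)) := by
  choose k hk using hc.2.2
  refine ⟨k, fun v => (hk v).trans ?_⟩
  ext x
  simp [eq_neg_add_iff_add_eq]

theorem eq_of_intCast_eq {x y : ℤ} (h : (x : ZMod t) = y) (hlt : |x - y| < t) : x = y := by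
  have h1 : (t : ℤ) ∣ y - x := (ZMod.intCast_eq_intCast_iff_dvd_sub x y t).1 h
  have := Int.eq_zero_of_abs_lt_dvd h1 (by rwa [abs_sub_comm])
  omega

/-- The cover of `G` obtained by unrolling the cyclically arranged colors `ZMod t` to `ℤ`; the
point `(v, s)` stands for the copy of `v` whose edges have the colors `s, …, s + d(v) - 1`. -/
noncomputable def unroll {c : Sym2 V → ZMod t} {k : V → ZMod t} {D : ℕ} (ht : 0 < t)
    (hc : IsIntervalCyclicColoring G t c)
    (hk : ∀ v, (G.neighborFinset v).image (fun w => c s(v, w)) =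
      (Finset.range (G.degree v)).image (fun i : ℕ => k v + (i : ZMod t)))
    (hD : ∀ v, G.degree v ≤ D) :
    LabelledCover {p : V × ℤ // (p.2 : ZMod t) = k p.1} V ((t : ℤ) - D) where
  proj p := p.1.1
  lo p := p.1.2
  hi p := p.1.2 + G.degree p.1.1 - 1
  edge p q x := G.Adj p.1.1 q.1.1 ∧ (x : ZMod t) = c s(p.1.1, q.1.1) ∧
    (p.1.2 ≤ x ∧ x ≤ p.1.2 + G.degree p.1.1 - 1) ∧
    (q.1.2 ≤ x ∧ x ≤ q.1.2 + G.degree q.1.1 - 1)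
  edge_symm := fun ⟨h1, h2, h3, h4⟩ => ⟨h1.symm, by rwa [Sym2.eq_swap], h4, h3⟩
  edge_irrefl := fun h => G.irrefl h.1
  lo_le := fun h => h.2.2.1.1
  le_hi := fun h => h.2.2.1.2
  exists_edge := by
    rintro ⟨⟨v, s⟩, hs⟩ x h1 h2
    simp only at hs h1 h2
    have hx : (x : ZMod t) ∈ (G.neighborFinset v).image (fun w => c s(v, w)) := by
      rw [hk v, Finset.mem_image]
      refine ⟨(x - s).toNat, Finset.mem_range.2 (by omega), ?_⟩
      have : (((x - s).toNat : ℤ) : ZMod t) = ((x - s : ℤ) : ZMod t) := by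
        rw [Int.toNat_of_nonneg (by omega)]
      rw [Int.cast_natCast] at this
      rw [this, ← hs]
      push_cast
      ring
    obtain ⟨w, hw, hwx⟩ := Finset.mem_image.1 hx
    have hvw : G.Adj v w := by simpa using hw
    have hx' : c s(w, v) ∈ (G.neighborFinset w).image (fun w' => c s(w, w')) :=
      Finset.mem_image_of_mem _ (by simpa using hvw.symm)
    rw [hk w, Finset.mem_image] at hx'
    obtain ⟨i, hi, hi'⟩ := hx'
    rw [Finset.mem_range] at hi
    refine ⟨⟨(w, x - i), ?_⟩, hvw, hwx.symm, ⟨h1, h2⟩, by simp only; omega, by simp only; omega⟩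
    simp only
    rw [Sym2.eq_swap, hwx] at hi'
    push_cast
    rw [← hi']
    ring
  label_unique := by
    rintro p q x y ⟨-, h1, h2, -⟩ ⟨-, h3, h4, -⟩
    refine eq_of_intCast_eq (h1.trans h3.symm) ?_
    have := hc.degree_le ht p.1.1
    rw [abs_lt]
    constructor <;> omega
  lift_unique := by
    rintro ⟨⟨v, r⟩, hr⟩ ⟨⟨w, s⟩, hs⟩ x y h h1 h2 h3 h4 h5
    simp only at h hr hs h1 h2 h3 h4
    subst h
    have := hD v
    have := abs_le.1 h5
    have h6 : r = s := eq_of_intCast_eq (hr.trans hs.symm) (by rw [abs_lt]; constructor <;> omega)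
    subst h6
    rfl

theorem LabelledCover.exists_reach {P W : Type*} {L : ℤ} (C : LabelledCover P W L) {a : ℤ}
    {p q : P} (hp : C.lo p ≤ a)
    (h : Relation.ReflTransGen (fun p q => ∃ x, C.edge p q x) p q) : ∃ m, C.Reach a m q := by
  induction h with
  | refl => exact ⟨0, hp⟩
  | tail _ h ih =>
    obtain ⟨m, hm⟩ := ih
    obtain ⟨x, hx⟩ := h
    exact ⟨m + 1, _, x, hm, hx⟩

theorem exists_sub_one_le_sub {t : ℕ} (ht : 0 < t) (f : ZMod t → ℤ) (hf : Function.Injective f) :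
    ∃ y z, (t : ℤ) - 1 ≤ f z - f y := by
  have : NeZero t := ⟨ht.ne'⟩
  obtain ⟨y, hy⟩ := Finite.exists_min f
  obtain ⟨z, hz⟩ := Finite.exists_max f
  refine ⟨y, z, ?_⟩
  have h := Finset.card_le_card_of_injOn (s := Finset.univ) (t := Finset.Icc (f y) (f z)) f
    (fun x _ => Finset.mem_coe.2 (Finset.mem_Icc.2 ⟨hy x, hz x⟩)) hf.injOn
  have := hy z
  rw [Finset.card_univ, ZMod.card, Int.card_Icc] at h
  omega

theorem HasIntervalCyclicColoring.le {D : ℕ} (h : HasIntervalCyclicColoring G t)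
    (hconn : G.Connected) (hD : ∀ v, G.degree v ≤ D) (hD' : 0 < D) :
    t + 2 ≤ Fintype.card V + D ∨ t + 5 ≤ 2 * Fintype.card V + D := by
  obtain ⟨ht, c, hc⟩ := h
  obtain ⟨k, hk⟩ := hc.exists_start
  let C := unroll ht hc hk hD
  let R := fun p q => ∃ x, C.edge p q x
  have : Std.Symm R := ⟨fun _ _ ⟨x, hx⟩ => ⟨x, C.edge_symm hx⟩⟩
  -- labels at a lift of `v` realise the colors of all edges at `v`
  have hlabel : ∀ (p : {p : V × ℤ // (p.2 : ZMod t) = k p.1}) (w : V), G.Adj p.1.1 w →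
      ∃ x : ℤ, (x : ZMod t) = c s(p.1.1, w) ∧ C.lo p ≤ x ∧ x ≤ C.hi p := by
    rintro ⟨⟨v, s⟩, hs⟩ w hvw
    simp only at hs hvw
    have hx : c s(v, w) ∈ (G.neighborFinset v).image (fun w' => c s(v, w')) :=
      Finset.mem_image_of_mem _ (by simpa using hvw)
    rw [hk v, Finset.mem_image] at hx
    obtain ⟨i, hi, hi'⟩ := hx
    rw [Finset.mem_range] at hi
    refine ⟨s + i, ?_, ?_, ?_⟩
    · push_cast
      rw [hs, hi']
    · change s ≤ s + i
      omega
    · change s + i ≤ s + G.degree v - 1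
      omega
  obtain ⟨v₀⟩ := hconn.nonempty
  obtain ⟨s₀, hs₀⟩ := ZMod.intCast_surjective (k v₀)
  let p₀ : {p : V × ℤ // (p.2 : ZMod t) = k p.1} := ⟨(v₀, s₀), hs₀⟩
  have hlift : ∀ v, ∃ p, Relation.ReflTransGen R p₀ p ∧ p.1.1 = v := by
    intro v
    obtain ⟨walk⟩ := hconn.preconnected v v₀
    induction walk with
    | nil => exact ⟨⟨(_, s₀), hs₀⟩, .refl, rfl⟩
    | @cons u v w huv _ ih =>
      obtain ⟨p, hp, rfl⟩ := ih hs₀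
      obtain ⟨x, hx, h1, h2⟩ := hlabel p u huv.symm
      obtain ⟨q, hq⟩ := C.exists_edge h1 h2
      refine ⟨q, hp.tail ⟨x, hq⟩, ?_⟩
      by_contra hne
      exact hc.1 p.1.1 q.1.1 u hq.1 huv.symm hne (hq.2.1.symm.trans hx)
  have hcol : ∀ y : ZMod t, ∃ p, ∃ x : ℤ, Relation.ReflTransGen R p₀ p ∧ (x : ZMod t) = y ∧
      C.lo p ≤ x ∧ x ≤ C.hi p := by
    intro y
    obtain ⟨e, he, rfl⟩ := hc.2.1 y
    induction e with
    | _ u w =>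
    obtain ⟨p, hp, rfl⟩ := hlift u
    obtain ⟨x, hx⟩ := hlabel p w he
    exact ⟨p, x, hp, hx⟩
  choose p f hp hf hlo hhi using hcol
  obtain ⟨y, z, hyz⟩ := exists_sub_one_le_sub ht f
    (Function.LeftInverse.injective (g := fun x : ℤ => (x : ZMod t)) hf)
  obtain ⟨m, hm⟩ := C.exists_reach (hlo y) ((Std.Symm.symm _ _ (hp y)).trans (hp z))
  have := C.le_of_reach (fun p => by
    have : G.degree p.1.1 < Fintype.card V := G.degree_lt_card_verts _
    change p.1.2 + G.degree p.1.1 - 1 - p.1.2 + 2 ≤ _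
    omega) ⟨f y, m, p z, hm, by have := hhi z; omega⟩
  omega

end Lift

/-- If `G` is a connected finite simple graph with at least two
vertices and `G ∈ N_c`, then `W_c(G) ≤ 2|V(G)| + Δ(G) − 4`; moreover, if `G` has at
least three vertices, then `W_c(G) ≤ 2|V(G)| + Δ(G) − 5`. -/
theorem stmt_2 {V : Type*} [Fintype V] (G : SimpleGraph V) [DecidableRel G.Adj]
    (hconn : G.Connected) (hcard : 2 ≤ Fintype.card V)
    (hNc : ∃ t, HasIntervalCyclicColoring G t) :
    Wc G ≤ 2 * Fintype.card V + G.maxDegree - 4 ∧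
      (3 ≤ Fintype.card V → Wc G ≤ 2 * Fintype.card V + G.maxDegree - 5) := by
  have hD : ∀ v, G.degree v ≤ G.maxDegree := G.degree_le_maxDegree
  have hpos : 0 < G.maxDegree := by
    have : Nontrivial V := Fintype.one_lt_card_iff_nontrivial.1 hcard
    obtain ⟨v⟩ := hconn.nonempty
    exact (hconn.preconnected.degree_pos_of_nontrivial v).trans_le (hD v)
  have key : ∀ t, HasIntervalCyclicColoring G t →
      t + 2 ≤ Fintype.card V + G.maxDegree ∨ t + 5 ≤ 2 * Fintype.card V + G.maxDegree := by
    intro t ht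
    refine ht.le hconn (fun v => ?_) hpos
    convert hD v
  refine ⟨csSup_le hNc fun t ht => ?_, fun h3 => csSup_le hNc fun t ht => ?_⟩
  · have := key t ht
    omega
  · have := key t ht
    omega

end IntervalCyclic
end

section
/- If G is a connected finite simple graph with at least two vertices and G ∈ N_c, then W_c(G) ≤ 3|V(G)| − 5. Moreover, if G has at least three vertices, then W_c(G) ≤ 3|V(G)| − 6. -/
attribute [local instance] Classical.propDecidable

namespace IntervalCyclic

variable {V : Type*}

/-- The displacement along the directed edge from `u` to `v`, where `pos u v` is the position of
the color of the edge `uv` in the list of colors at `u`. -/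
def displacement {V : Type*} (pos : V → V → ℤ) (u v : V) : ℤ := pos u v - pos v u

/-- The total displacement along a walk. -/
def walkSum {V : Type*} {G : SimpleGraph V} (pos : V → V → ℤ) :
    ∀ {u v : V}, G.Walk u v → ℤ
  | _, _, .nil => 0
  | u, _, .cons (v := x) _ p => displacement pos u x + walkSum pos p

section Walks

variable {V : Type*} {G : SimpleGraph V} (pos : V → V → ℤ)

lemma walkSum_append {u v w : V} (p : G.Walk u v) (q : G.Walk v w) :
    walkSum pos (p.append q) = walkSum pos p + walkSum pos q := by
  induction p with
  | nil => simp [walkSum]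
  | cons h p ih => simp [walkSum, ih, add_assoc]

lemma walkSum_eq_sum_getVert {u v : V} (p : G.Walk u v) :
    walkSum pos p =
      ∑ i ∈ Finset.range p.length, displacement pos (p.getVert i) (p.getVert (i + 1)) := by
  induction p with
  | nil => simp [walkSum]
  | cons h p ih =>
    rw [SimpleGraph.Walk.length_cons, Finset.sum_range_succ']
    simp only [walkSum, ih, SimpleGraph.Walk.getVert_cons_succ, SimpleGraph.Walk.getVert_zero]
    ring

lemma walkSum_reverse {u v : V} (p : G.Walk u v) :
    walkSum pos p.reverse = -walkSum pos p := by
  induction p with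
  | nil => simp [walkSum]
  | cons h p ih =>
    rw [SimpleGraph.Walk.reverse_cons, walkSum_append, ih]
    simp only [walkSum, displacement]
    ring

/-- The displacement along a walk, modulo `t`, only depends on the endpoints. -/
lemma intCast_walkSum {t : ℕ} {k : V → ZMod t}
    (hk : ∀ u v, G.Adj u v → k u + (pos u v : ZMod t) = k v + (pos v u : ZMod t))
    {u v : V} (p : G.Walk u v) : ((walkSum pos p : ℤ) : ZMod t) = k v - k u := by
  induction p with
  | nil => simp [walkSum]
  | cons h p ih =>
    have := hk _ _ h
    simp only [walkSum, displacement]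
    push_cast
    rw [ih]
    linear_combination this

lemma exists_walk_segment {f : ℕ → V} (hf : ∀ i, G.Adj (f i) (f (i + 1))) (i n : ℕ) :
    ∃ q : G.Walk (f i) (f (i + n)), q.length = n ∧
      walkSum pos q = ∑ j ∈ Finset.range (i + n), displacement pos (f j) (f (j + 1)) -
        ∑ j ∈ Finset.range i, displacement pos (f j) (f (j + 1)) := by
  induction n with
  | zero => exact ⟨.nil, by simp [walkSum]⟩
  | succ n ih =>
    obtain ⟨q, hq, hs⟩ := ih
    refine ⟨q.append (.cons (hf (i + n)) .nil), by simp [hq], ?_⟩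
    have hsucc := Finset.sum_range_succ (fun j => displacement pos (f j) (f (j + 1))) (i + n)
    rw [walkSum_append, hs]
    simp only [walkSum]
    rw [show i + (n + 1) = i + n + 1 from rfl, hsucc]
    ring

end Walks

lemma card_le_three_of_no_chain (s : Finset ℕ)
    (h : ∀ a ∈ s, ∀ b ∈ s, ∀ c ∈ s, ∀ d ∈ s, a < b → b < c → c < d → False) :
    s.card ≤ 3 := by
  by_contra hcon
  obtain ⟨r, hrs, hr⟩ := Finset.exists_subset_card_eq (show 4 ≤ s.card by omega)
  have hmem : ∀ i, r.orderEmbOfFin hr i ∈ s := fun i => hrs (Finset.orderEmbOfFin_mem r hr i)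
  have hlt : ∀ {i j : Fin 4}, i < j → r.orderEmbOfFin hr i < r.orderEmbOfFin hr j :=
    fun hij => (r.orderEmbOfFin hr).strictMono hij
  exact h _ (hmem 0) _ (hmem 1) _ (hmem 2) _ (hmem 3) (hlt (by decide)) (hlt (by decide))
    (hlt (by decide))

/-- If every vertex has at most three neighbors among `m` distinct vertices, and each of these
`m` vertices has at most two, then their degrees sum to at most `3|V| - m`. -/
lemma sum_degree_add_le {V : Type*} [Fintype V] (G : SimpleGraph V) (f : ℕ → V) (m : ℕ)
    (hinj : Set.InjOn f (Finset.range m))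
    (h3 : ∀ w, ((Finset.range m).filter fun i => G.Adj w (f i)).card ≤ 3)
    (h2 : ∀ a < m, ((Finset.range m).filter fun i => G.Adj (f a) (f i)).card ≤ 2) :
    ∑ i ∈ Finset.range m, G.degree (f i) + m ≤ 3 * Fintype.card V := by
  have hdeg : ∑ i ∈ Finset.range m, G.degree (f i) =
      ∑ w : V, ((Finset.range m).filter fun i => G.Adj w (f i)).card := by
    simp_rw [Finset.card_filter]
    rw [Finset.sum_comm]
    refine Finset.sum_congr rfl fun i _ => ?_
    rw [← Finset.card_filter, ← SimpleGraph.card_neighborFinset_eq_degree]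
    congr 1
    ext w
    simp [SimpleGraph.adj_comm]
  have hm : m = ∑ w : V, if w ∈ (Finset.range m).image f then 1 else 0 := by
    rw [← Finset.card_filter]
    rw [Finset.filter_univ_mem]
    rw [Finset.card_image_of_injOn hinj, Finset.card_range]
  have hsum : ∑ w : V, (((Finset.range m).filter fun i => G.Adj w (f i)).card +
      if w ∈ (Finset.range m).image f then 1 else 0) ≤ ∑ _w : V, 3 := by
    refine Finset.sum_le_sum fun w _ => ?_
    split_ifs with hw
    · obtain ⟨a, ha, rfl⟩ := Finset.mem_image.1 hw
      have := h2 a (Finset.mem_range.1 ha)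
      omega
    · simpa using h3 w
  rw [Finset.sum_add_distrib, ← hdeg, ← hm] at hsum
  simpa [mul_comm] using hsum

section Bounds

variable {V : Type*} [Fintype V] {G : SimpleGraph V} {pos : V → V → ℤ}

/-- A shortest closed walk with positive total displacement `s` satisfies `s ≤ 3|V| - 6`. -/
lemma walkSum_closed_le_of_minimal
    (hpos : ∀ u v, G.Adj u v → 0 ≤ pos u v ∧ pos u v + 1 ≤ G.degree u)
    {u : V} (p : G.Walk u u) (hp : 0 < walkSum pos p)
    (hmin : ∀ (x : V) (q : G.Walk x x), q.length < p.length → walkSum pos q = 0) :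
    walkSum pos p + 6 ≤ 3 * Fintype.card V := by
  obtain ⟨m, hm⟩ : ∃ m, m = p.length := ⟨_, rfl⟩
  rw [← hm] at hmin
  have hm0 : 0 < m := by
    rcases Nat.eq_zero_or_pos m with h | h
    · rw [walkSum_eq_sum_getVert, ← hm, h] at hp
      simp at hp
    · exact h
  let f : ℕ → V := fun i => p.getVert (i % m)
  have hper : ∀ i, f (i + m) = f i := fun i => by simp [f]
  have hfp : ∀ i ≤ m, f i = p.getVert i := by
    intro i hi
    rcases hi.lt_or_eq with h | h
    · simp [f, Nat.mod_eq_of_lt h]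
    · simp only [f, h, Nat.mod_self, SimpleGraph.Walk.getVert_zero]
      rw [hm, SimpleGraph.Walk.getVert_length]
  have hadj : ∀ i, G.Adj (f i) (f (i + 1)) := by
    intro i
    have hlt := Nat.mod_lt i hm0
    have h1 : f (i + 1) = f (i % m + 1) := by simp [f]
    rw [h1, hfp (i % m + 1) hlt]
    exact p.adj_getVert_succ (hm ▸ hlt)
  let F : ℕ → ℤ := fun n => ∑ j ∈ Finset.range n, displacement pos (f j) (f (j + 1))
  have hFm : F m = walkSum pos p := by
    rw [walkSum_eq_sum_getVert, ← hm]
    refine Finset.sum_congr rfl fun i hi => ?_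
    have := Finset.mem_range.1 hi
    rw [hfp i (by omega), hfp (i + 1) (by omega)]
  have hFper : ∀ i, F (i + m) = F i + F m := by
    intro i
    induction i with
    | zero => simp [F]
    | succ i ih =>
      have e1 : F (i + 1 + m) = F (i + m) + displacement pos (f (i + m)) (f (i + m + 1)) := by
        rw [show i + 1 + m = i + m + 1 by ring]
        exact Finset.sum_range_succ _ _
      have e2 : F (i + 1) = F i + displacement pos (f i) (f (i + 1)) :=
        Finset.sum_range_succ _ _
      rw [e1, e2, ih, show i + m + 1 = i + 1 + m by ring, hper, hper]
      ring
  have hseg : ∀ i j, i ≤ j → ∃ q : G.Walk (f i) (f j), q.length = j - i ∧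
      walkSum pos q = F j - F i := by
    intro i j hij
    obtain ⟨n, rfl⟩ := Nat.exists_eq_add_of_le hij
    simpa using exists_walk_segment pos hadj i n
  have hsector : ∀ w i j, i ≤ j → j - i + 2 < m → G.Adj w (f i) → G.Adj w (f j) →
      displacement pos w (f i) + (F j - F i) - displacement pos w (f j) = 0 := by
    intro w i j hij hlen hi hj
    obtain ⟨q, hq, hs⟩ := hseg i j hij
    have := hmin w (.cons hi (q.append (.cons hj.symm .nil))) (by simp [hq]; omega)
    simp only [walkSum, walkSum_append, hs, displacement] at this
    simp only [displacement]
    linarith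
  have hchord : ∀ i j, i ≤ j → j - i + 1 < m → G.Adj (f i) (f j) →
      F j - F i - displacement pos (f i) (f j) = 0 := by
    intro i j hij hlen h
    obtain ⟨q, hq, hs⟩ := hseg i j hij
    have := hmin (f i) (q.append (.cons h.symm .nil)) (by simp [hq]; omega)
    simp only [walkSum, walkSum_append, hs, displacement] at this
    simp only [displacement]
    linarith
  have hnochord : ∀ i j, i < j → j < m → G.Adj (f i) (f j) → j = i + 1 ∨ j + 1 = i + m := by
    intro i j hij hj h
    by_contra hcon
    have h1 := hchord i j hij.le (by omega) h
    have h2 := hchord j (i + m) (by omega) (by omega) (by rw [hper]; exact h.symm)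
    rw [hper, hFper] at h2
    simp only [displacement] at h1 h2
    linarith
  have hclosed : ∀ i j, i ≤ j → j - i < m → f i = f j → F j - F i = 0 := by
    intro i j hij hlen h
    obtain ⟨q, hq, hs⟩ := hseg i j hij
    rw [← hs]
    clear hs
    revert q
    rw [← h]
    intro q hq
    exact hmin _ q (by omega)
  have hne : ∀ i j, i < j → j < m → f i ≠ f j := by
    intro i j hij hj h
    have h1 := hclosed i j hij.le (by omega) h
    have h2 := hclosed j (i + m) (by omega) (by omega) (by rw [hper]; exact h.symm)
    rw [hFper] at h2
    linarith
  have hinj : Set.InjOn f (Finset.range m) := by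
    intro i hi j hj h
    have hi' : i < m := by simpa using hi
    have hj' : j < m := by simpa using hj
    rcases lt_trichotomy i j with hlt | heq | hlt
    · exact (hne i j hlt hj' h).elim
    · exact heq
    · exact (hne j i hlt hi' h.symm).elim
  have h3 : ∀ w, ((Finset.range m).filter fun i => G.Adj w (f i)).card ≤ 3 := by
    intro w
    refine card_le_three_of_no_chain _ ?_
    simp only [Finset.mem_filter, Finset.mem_range]
    rintro a ⟨ha, wa⟩ b ⟨hb, wb⟩ c ⟨hc, wc⟩ d ⟨hd, wd⟩ hab hbc hcd
    have h1 := hsector w a b hab.le (by omega) wa wb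
    have h2 := hsector w b c hbc.le (by omega) wb wc
    have h3 := hsector w c d hcd.le (by omega) wc wd
    have h4 := hsector w d (a + m) (by omega) (by omega) wd (by rwa [hper])
    rw [hper, hFper] at h4
    linarith
  have h2 : ∀ a < m, ((Finset.range m).filter fun i => G.Adj (f a) (f i)).card ≤ 2 := by
    intro a ha
    refine (Finset.card_le_card (t := {if a + 1 < m then a + 1 else 0,
      if a = 0 then m - 1 else a - 1}) ?_).trans Finset.card_le_two
    intro i hi
    simp only [Finset.mem_filter, Finset.mem_range] at hi
    obtain ⟨him, hai⟩ := hi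
    simp only [Finset.mem_insert, Finset.mem_singleton]
    rcases lt_trichotomy a i with hlt | heq | hlt
    · have := hnochord a i hlt him hai
      split_ifs <;> omega
    · exact (hai.ne (by rw [heq])).elim
    · have := hnochord i a hlt ha hai.symm
      split_ifs <;> omega
  have hsum := sum_degree_add_le G f m hinj h3 h2
  have hle : F m ≤ ∑ i ∈ Finset.range m, ((G.degree (f i) : ℤ) - 1) := by
    refine Finset.sum_le_sum fun i _ => ?_
    have h1 := hpos _ _ (hadj i)
    have h2 := hpos _ _ (hadj i).symm
    simp only [displacement]
    linarith
  have hm3 : 3 ≤ m := by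
    by_contra hcon
    have hm12 : m = 1 ∨ m = 2 := by omega
    rcases hm12 with h | h
    · have h0 := hadj 0
      have h1 := hper 0
      rw [h] at h1
      exact h0.ne h1.symm
    · have h1 := hper 0
      rw [h] at h1
      have : F m = 0 := by
        simp only [F, h, Finset.sum_range_succ, Finset.sum_range_zero, displacement]
        simp only [zero_add] at h1 ⊢
        rw [h1]
        ring
      omega
  simp only [Finset.sum_sub_distrib, Finset.sum_const, Finset.card_range, nsmul_eq_mul,
    mul_one] at hle
  rw [hFm] at hle
  zify at hsum
  have hm3' : (3 : ℤ) ≤ m := by exact_mod_cast hm3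
  linarith

/-- If some closed walk has nonzero total displacement, then some closed walk has total
displacement in `(0, 3|V| - 6]`. -/
lemma exists_closed_walkSum_le
    (hpos : ∀ u v, G.Adj u v → 0 ≤ pos u v ∧ pos u v + 1 ≤ G.degree u)
    (h : ∃ (u : V) (p : G.Walk u u), walkSum pos p ≠ 0) :
    ∃ (u : V) (p : G.Walk u u), 0 < walkSum pos p ∧
      walkSum pos p + 6 ≤ 3 * Fintype.card V := by
  have hex : ∃ m, ∃ (u : V) (p : G.Walk u u), p.length = m ∧ walkSum pos p ≠ 0 := by
    obtain ⟨u, p, hp⟩ := h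
    exact ⟨_, u, p, rfl, hp⟩
  obtain ⟨u, p, hlen, hp⟩ := Nat.find_spec hex
  have hmin : ∀ (x : V) (q : G.Walk x x), q.length < p.length → walkSum pos q = 0 := by
    intro x q hq
    by_contra hne
    exact Nat.find_min hex (hlen ▸ hq) ⟨x, q, rfl, hne⟩
  rcases lt_or_gt_of_ne hp with hneg | hgt
  · have hrev : 0 < walkSum pos p.reverse := by
      rw [walkSum_reverse]
      omega
    exact ⟨u, p.reverse, hrev,
      walkSum_closed_le_of_minimal hpos p.reverse hrev (by simpa using hmin)⟩
  · exact ⟨u, p, hgt, walkSum_closed_le_of_minimal hpos p hgt hmin⟩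

/-- The sum of `d(x) - 1` over the vertices `x` of a geodesic is at most `3|V| - 7`, or at most
`2|V| - 4` if the geodesic has at most two vertices. -/
lemma sum_degree_geodesic_le (hconn : G.Connected) (hcard : 2 ≤ Fintype.card V)
    {u v : V} (p : G.Walk u v) (hp : p.length = G.dist u v) :
    ∑ i ∈ Finset.range (p.length + 1), ((G.degree (p.getVert i) : ℤ) - 1) ≤
      max (2 * (Fintype.card V : ℤ) - 4) (3 * Fintype.card V - 7) := by
  have hd : ∀ i j, i ≤ j → j ≤ p.length → j ≤ i + G.dist (p.getVert i) (p.getVert j) := by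
    intro i j hij hj
    have h1 := hconn.dist_triangle (u := u) (v := p.getVert i) (w := v)
    have h2 := hconn.dist_triangle (u := p.getVert i) (v := p.getVert j) (w := v)
    have h3 := SimpleGraph.dist_le (p.take i)
    have h4 := SimpleGraph.dist_le (p.drop j)
    rw [SimpleGraph.Walk.take_length] at h3
    rw [SimpleGraph.Walk.drop_length] at h4
    omega
  have hadj : ∀ i j, i ≤ j → j ≤ p.length → G.Adj (p.getVert i) (p.getVert j) → j ≤ i + 1 := by
    intro i j hij hj h
    have := hd i j hij hj
    rw [SimpleGraph.dist_eq_one_iff_adj.2 h] at this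
    exact this
  have hdeg : ∀ x, G.degree x + 1 ≤ Fintype.card V := fun x => G.degree_lt_card_verts x
  have hinj : Set.InjOn p.getVert (Finset.range (p.length + 1)) := by
    intro i hi j hj h
    have hi' : i < p.length + 1 := by simpa using hi
    have hj' : j < p.length + 1 := by simpa using hj
    rcases le_total i j with hle | hle
    · have := hd i j hle (by omega)
      rw [h, SimpleGraph.dist_self] at this
      omega
    · have := hd j i hle (by omega)
      rw [h, SimpleGraph.dist_self] at this
      omega
  rcases Nat.lt_or_ge p.length 3 with hlt | hge
  · have hcases : p.length = 0 ∨ p.length = 1 ∨ p.length = 2 := by omega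
    have d0 := hdeg (p.getVert 0)
    have d1 := hdeg (p.getVert 1)
    rcases hcases with h | h | h
    · simp only [h, Finset.sum_range_succ, Finset.sum_range_zero, zero_add]
      refine le_max_of_le_left ?_
      omega
    · simp only [h, Finset.sum_range_succ, Finset.sum_range_zero, zero_add]
      refine le_max_of_le_left ?_
      omega
    · have hn02 : ¬ G.Adj (p.getVert 0) (p.getVert 2) := fun hh => by
        have := hadj 0 2 (by omega) (by omega) hh
        omega
      have hne : p.getVert 0 ≠ p.getVert 2 := fun hh => by
        have := hinj (by simp) (by simp [h]) hh
        omega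
      have hdeg2 : ∀ x y, x ≠ y → ¬ G.Adj x y → G.degree x + 2 ≤ Fintype.card V := by
        intro x y hxy hn
        have hsub : insert x (insert y (G.neighborFinset x)) ⊆ Finset.univ :=
          Finset.subset_univ _
        have := Finset.card_le_card hsub
        rwa [Finset.card_insert_of_notMem (by simp [hxy]),
          Finset.card_insert_of_notMem (by simpa using hn),
          SimpleGraph.card_neighborFinset_eq_degree, Finset.card_univ] at this
      have e0 := hdeg2 _ _ hne hn02
      have e2 := hdeg2 _ _ hne.symm (fun hh => hn02 hh.symm)
      simp only [h, Finset.sum_range_succ, Finset.sum_range_zero, zero_add]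
      refine le_max_of_le_right ?_
      omega
  · have hsum := sum_degree_add_le G p.getVert (p.length + 1) hinj (by
      intro w
      refine card_le_three_of_no_chain _ ?_
      simp only [Finset.mem_filter, Finset.mem_range]
      rintro a ⟨ha, wa⟩ b ⟨hb, wb⟩ c ⟨hc, wc⟩ d ⟨hd', wd⟩ hab hbc hcd
      have h1 := hd a d (by omega) (by omega)
      have h2 := hconn.dist_triangle (u := p.getVert a) (v := w) (w := p.getVert d)
      rw [SimpleGraph.dist_eq_one_iff_adj.2 wa.symm, SimpleGraph.dist_eq_one_iff_adj.2 wd] at h2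
      omega) (by
      intro a ha
      refine (Finset.card_le_card (t := {a + 1, a - 1}) ?_).trans Finset.card_le_two
      intro i hi
      simp only [Finset.mem_filter, Finset.mem_range] at hi
      obtain ⟨him, hai⟩ := hi
      simp only [Finset.mem_insert, Finset.mem_singleton]
      have hne : a ≠ i := fun h => hai.ne (by rw [h])
      rcases le_total a i with hle | hle
      · have := hadj a i hle (by omega) hai
        omega
      · have := hadj i a hle (by omega) hai.symm
        omega)
    refine le_max_of_le_right ?_
    simp only [Finset.sum_sub_distrib, Finset.sum_const, Finset.card_range, nsmul_eq_mul, mul_one]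
    zify at hsum
    have : (3 : ℤ) ≤ p.length := by exact_mod_cast hge
    push_cast
    linarith

/-- The displacement between two edges, measured along a geodesic, is at most `2|V| - 4` or at
most `3|V| - 7`. -/
lemma walkSum_geodesic_le (hconn : G.Connected) (hcard : 2 ≤ Fintype.card V)
    (hpos : ∀ u v, G.Adj u v → 0 ≤ pos u v ∧ pos u v + 1 ≤ G.degree u)
    {u v x y : V} (hx : G.Adj u x) (hy : G.Adj v y)
    (p : G.Walk u v) (hp : p.length = G.dist u v) :
    walkSum pos p + pos v y - pos u x ≤
      max (2 * (Fintype.card V : ℤ) - 4) (3 * Fintype.card V - 7) := by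
  refine le_trans ?_ (sum_degree_geodesic_le hconn hcard p hp)
  rw [walkSum_eq_sum_getVert, Finset.sum_range_succ, SimpleGraph.Walk.getVert_length]
  have h1 : ∑ i ∈ Finset.range p.length, displacement pos (p.getVert i) (p.getVert (i + 1)) ≤
      ∑ i ∈ Finset.range p.length, ((G.degree (p.getVert i) : ℤ) - 1) := by
    refine Finset.sum_le_sum fun i hi => ?_
    have h := p.adj_getVert_succ (Finset.mem_range.1 hi)
    have h1 := hpos _ _ h
    have h2 := hpos _ _ h.symm
    simp only [displacement]
    linarith
  have h2 := hpos _ _ hx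
  have h3 := hpos _ _ hy
  linarith

end Bounds

/-- The positions of the colors of the edges at each vertex. -/
lemma IsIntervalCyclicColoring.exists_pos {V : Type*} [Fintype V] {G : SimpleGraph V} {t : ℕ}
    {c : Sym2 V → ZMod t} (hc : IsIntervalCyclicColoring G t c) :
    ∃ (k : V → ZMod t) (pos : V → V → ℤ), ∀ u v, G.Adj u v →
      (0 ≤ pos u v ∧ pos u v + 1 ≤ G.degree u) ∧ c s(u, v) = k u + (pos u v : ZMod t) := by
  obtain ⟨-, -, hint⟩ := hc
  choose k hk using hint
  have hex : ∀ u v, ∃ i : ℤ, G.Adj u v →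
      (0 ≤ i ∧ i + 1 ≤ G.degree u) ∧ c s(u, v) = k u + (i : ZMod t) := by
    intro u v
    by_cases h : G.Adj u v
    · have hmem : c s(u, v) ∈ (G.neighborFinset u).image (fun w => c s(u, w)) :=
        Finset.mem_image_of_mem (fun w => c s(u, w)) (by simpa using h)
      rw [hk u] at hmem
      obtain ⟨i, hi, he⟩ := Finset.mem_image.1 hmem
      simp only [Finset.bind_def, Finset.mem_sup, Finset.mem_range, Finset.pure_def,
        Finset.mem_singleton] at hi
      obtain ⟨n, hn, rfl⟩ := hi
      exact ⟨n, fun _ => ⟨⟨by omega, by omega⟩, by simpa using he.symm⟩⟩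
    · exact ⟨0, fun h' => (h h').elim⟩
  choose pos hpos using hex
  exact ⟨k, pos, hpos⟩

lemma HasIntervalCyclicColoring.le_max {V : Type*} [Fintype V] {G : SimpleGraph V} {t : ℕ}
    (hconn : G.Connected) (hcard : 2 ≤ Fintype.card V) (h : HasIntervalCyclicColoring G t) :
    (t : ℤ) ≤ max (2 * (Fintype.card V : ℤ) - 3) (3 * Fintype.card V - 6) := by
  obtain ⟨ht, c, hc⟩ := h
  obtain ⟨k, pos, hkpos⟩ := hc.exists_pos
  have hpos := fun u v h => (hkpos u v h).1
  have hcol := fun u v h => (hkpos u v h).2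
  have hk : ∀ u v, G.Adj u v → k u + (pos u v : ZMod t) = k v + (pos v u : ZMod t) := by
    intro u v h
    rw [← hcol u v h, ← hcol v u h.symm, Sym2.eq_swap]
  by_cases hclosed : ∃ (u : V) (p : G.Walk u u), walkSum pos p ≠ 0
  · obtain ⟨u, p, hp, hle⟩ := exists_closed_walkSum_le hpos hclosed
    have hcast := intCast_walkSum pos hk p
    rw [sub_self, ZMod.intCast_zmod_eq_zero_iff_dvd _ t] at hcast
    have := Int.le_of_dvd hp hcast
    refine le_max_of_le_right ?_
    linarith
  · push Not at hclosed
    obtain ⟨r⟩ := hconn.nonempty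
    let φ : V → ℤ := fun v => walkSum pos (hconn r v).some
    have hφ : ∀ {u v : V} (p : G.Walk u v), walkSum pos p = φ v - φ u := by
      intro u v p
      have := hclosed r (((hconn r u).some.append p).append (hconn r v).some.reverse)
      rw [walkSum_append, walkSum_append, walkSum_reverse] at this
      simp only [φ]
      linarith
    let E : Finset (V × V) := Finset.univ.filter fun e => G.Adj e.1 e.2
    let T : Finset ℤ := E.image fun e => φ e.1 + pos e.1 e.2
    have : NeZero t := ⟨ht.ne'⟩
    have hsurj : ∀ x : ZMod t, ∃ z ∈ T, ((z : ℤ) : ZMod t) = x := by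
      intro x
      obtain ⟨e, he, hx⟩ := hc.2.1 (x + k r)
      induction e using Sym2.ind with
      | _ a b =>
        have hab : G.Adj a b := by simpa using he
        refine ⟨φ a + pos a b, Finset.mem_image.2 ⟨(a, b), by simp [E, hab], rfl⟩, ?_⟩
        have h1 : ((φ a : ℤ) : ZMod t) = k a - k r := intCast_walkSum pos hk _
        have h2 := hcol a b hab
        push_cast
        rw [h1]
        linear_combination hx - h2
    have hcardT : t ≤ T.card := by
      have hsub : (Finset.univ : Finset (ZMod t)) ⊆ T.image fun z : ℤ => (z : ZMod t) := by
        intro x _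
        exact Finset.mem_image.2 (hsurj x)
      have := (Finset.card_le_card hsub).trans Finset.card_image_le
      rwa [Finset.card_univ, ZMod.card] at this
    have hne : T.Nonempty := Finset.card_pos.1 (by omega)
    have hIcc : T ⊆ Finset.Icc (T.min' hne) (T.max' hne) := fun z hz =>
      Finset.mem_Icc.2 ⟨T.min'_le z hz, T.le_max' z hz⟩
    have hspan := Finset.card_le_card hIcc
    rw [Int.card_Icc] at hspan
    obtain ⟨⟨u, x⟩, hux, hmin⟩ := Finset.mem_image.1 (T.min'_mem hne)
    obtain ⟨⟨v, y⟩, hvy, hmax⟩ := Finset.mem_image.1 (T.max'_mem hne)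
    have hux' : G.Adj u x := by simpa [E] using hux
    have hvy' : G.Adj v y := by simpa [E] using hvy
    obtain ⟨p, hp⟩ := hconn.exists_walk_length_eq_dist u v
    have hle := walkSum_geodesic_le hconn hcard hpos hux' hvy' p hp
    rw [hφ p] at hle
    simp only at hmin hmax
    rw [← hmin, ← hmax] at hspan
    rcases le_max_iff.1 hle with h | h
    · refine le_max_of_le_left ?_
      omega
    · refine le_max_of_le_right ?_
      omega

/-- If `G` is a connected finite simple graph with at least two
vertices and `G ∈ N_c`, then `W_c(G) ≤ 3|V(G)| − 5`; moreover, if `G` has at least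
three vertices, then `W_c(G) ≤ 3|V(G)| − 6`. -/
theorem stmt_3 {V : Type*} [Fintype V] (G : SimpleGraph V)
    (hconn : G.Connected) (hcard : 2 ≤ Fintype.card V)
    (hNc : ∃ t, HasIntervalCyclicColoring G t) :
    Wc G ≤ 3 * Fintype.card V - 5 ∧
      (3 ≤ Fintype.card V → Wc G ≤ 3 * Fintype.card V - 6) := by
  have hle : ∀ t ∈ {t | HasIntervalCyclicColoring G t},
      (t : ℤ) ≤ max (2 * (Fintype.card V : ℤ) - 3) (3 * Fintype.card V - 6) :=
    fun t ht => HasIntervalCyclicColoring.le_max hconn hcard ht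
  refine ⟨csSup_le hNc fun t ht => ?_, fun h3 => csSup_le hNc fun t ht => ?_⟩
  · rcases le_max_iff.1 (hle t ht) with h | h <;> omega
  · rcases le_max_iff.1 (hle t ht) with h | h <;> omega

end IntervalCyclic
end

section
/- If G is an interval cyclically colorable Eulerian finite simple graph with an odd number of edges and with chromatic index χ'(G) = Δ(G), then w_c(G) > χ'(G). -/
attribute [local instance] Classical.propDecidable

namespace IntervalCyclic

variable {V : Type*}

/-- The chromatic index (edge chromatic number) of `G`: the least number `k` of
colors admitting a proper edge-coloring of `G`. -/
noncomputable def chromaticIndex [Fintype V] (G : SimpleGraph V) : ℕ :=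
  sInf {k : ℕ | ∃ c : Sym2 V → ℕ, (∀ e ∈ G.edgeSet, c e < k) ∧
    ∀ v w w' : V, G.Adj v w → G.Adj v w' → w ≠ w' → c s(v, w) ≠ c s(v, w')}

/-- Among an even number of consecutive shifts of an element of `ZMod 2`, exactly half vanish. -/
lemma two_mul_card_filter_range_eq_zero (a : ZMod 2) (m : ℕ) :
    2 * ((Finset.range (m + m)).filter (fun i : ℕ => a + (i : ZMod 2) = 0)).card = m + m := by
  induction m with
  | zero => simp
  | succ m ih =>
    have h2 : ((m + m : ℕ) : ZMod 2) = 0 := by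
      push_cast
      exact CharTwo.add_self_eq_zero _
    have h : m + 1 + (m + 1) = m + m + 1 + 1 := by omega
    rw [h, Finset.range_add_one, Finset.filter_insert, Finset.range_add_one, Finset.filter_insert,
      Nat.cast_succ, h2]
    have ha : a = 0 ∨ a = 1 := by
      clear ih
      revert a
      decide
    have h11 : (1 : ZMod 2) + 1 = 0 := by decide
    rcases ha with rfl | rfl <;> simp [h11] at ih ⊢ <;> omega

/-- The number of colors is at least the degree of every vertex. -/
lemma HasIntervalCyclicColoring.degree_le [Fintype V] {G : SimpleGraph V} {t : ℕ}
    (h : HasIntervalCyclicColoring G t) (v : V) : G.degree v ≤ t := by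
  obtain ⟨ht, c, hc, -, -⟩ := h
  have : NeZero t := ⟨ht.ne'⟩
  rw [← G.card_neighborFinset_eq_degree, ← ZMod.card t]
  refine Finset.card_le_card_of_injOn (fun w => c s(v, w)) (fun _ _ => Finset.mem_univ _) ?_
  intro w hw w' hw' hww
  by_contra hne
  exact hc v w w' (by simpa using hw) (by simpa using hw') hne hww

/-- In an interval cyclic coloring with an even number of colors, exactly half of the edges at a
vertex of even degree have an even color. -/
lemma IsIntervalCyclicColoring.two_mul_card_filter [Fintype V] {G : SimpleGraph V} {t : ℕ}
    {c : Sym2 V → ZMod t} (h : IsIntervalCyclicColoring G t c) (ht : 2 ∣ t) {v : V}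
    (hv : Even (G.degree v)) :
    2 * ((G.neighborFinset v).filter
      (fun w => ZMod.castHom ht (ZMod 2) (c s(v, w)) = 0)).card = G.degree v := by
  obtain ⟨hc, -, hint⟩ := h
  obtain ⟨k, hk'⟩ := hint v
  have hk : (G.neighborFinset v).image (fun w => c s(v, w)) =
      (Finset.range (G.degree v)).image (fun i : ℕ => k + (i : ZMod t)) := by
    rw [hk']
    ext x
    simp [Finset.bind_def, eq_neg_add_iff_add_eq]
  have hinj : Set.InjOn (fun w => c s(v, w)) (G.neighborFinset v : Set V) := by
    intro w hw w' hw' hww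
    by_contra hne
    exact hc v w w' (by simpa using hw) (by simpa using hw') hne hww
  have hinj' : Set.InjOn (fun i : ℕ => k + (i : ZMod t)) (Finset.range (G.degree v) : Set ℕ) := by
    rw [← Finset.card_image_iff, ← hk, Finset.card_image_of_injOn hinj]
    simp
  have h1 := congrArg
    (fun s : Finset (ZMod t) => (s.filter (fun x => ZMod.castHom ht (ZMod 2) x = 0)).card) hk
  simp only [Finset.filter_image] at h1
  rw [Finset.card_image_of_injOn (hinj.mono (Finset.coe_subset.2 (Finset.filter_subset _ _))),
    Finset.card_image_of_injOn (hinj'.mono (Finset.coe_subset.2 (Finset.filter_subset _ _)))] at h1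
  rw [h1]
  obtain ⟨m, hm⟩ := hv
  rw [hm]
  simp only [map_add, map_natCast]
  convert two_mul_card_filter_range_eq_zero (ZMod.castHom ht (ZMod 2) k) m

/-- A graph with all degrees even that has an interval cyclic coloring with an even number of
colors has an even number of edges. -/
lemma IsIntervalCyclicColoring.even_card_edgeFinset [Fintype V] {G : SimpleGraph V} {t : ℕ}
    {c : Sym2 V → ZMod t} (h : IsIntervalCyclicColoring G t c) (ht : 2 ∣ t)
    (heven : ∀ v, Even (G.degree v)) : Even G.edgeFinset.card := by
  let H : SimpleGraph V :=
    { Adj := fun v w => G.Adj v w ∧ ZMod.castHom ht (ZMod 2) (c s(v, w)) = 0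
      symm := ⟨fun v w hvw => ⟨hvw.1.symm, by rw [Sym2.eq_swap]; exact hvw.2⟩⟩
      loopless := ⟨fun v hv => G.loopless.irrefl v hv.1⟩ }
  have hH : ∀ v, 2 * H.degree v = G.degree v := by
    intro v
    rw [← h.two_mul_card_filter ht (heven v), ← H.card_neighborFinset_eq_degree]
    congr 2
    ext w
    rw [SimpleGraph.mem_neighborFinset, Finset.mem_filter, SimpleGraph.mem_neighborFinset]
  have hG := G.sum_degrees_eq_twice_card_edges
  simp_rw [← hH] at hG
  rw [← Finset.mul_sum, H.sum_degrees_eq_twice_card_edges] at hG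
  exact ⟨H.edgeFinset.card, by omega⟩

/-- If `G` is an interval cyclically colorable Eulerian finite
simple graph with an odd number of edges and with chromatic index `χ'(G) = Δ(G)`,
then `w_c(G) > χ'(G)`. -/
theorem stmt_11 {V : Type*} [Fintype V] (G : SimpleGraph V) [DecidableRel G.Adj]
    (hconn : G.Connected) (heven : ∀ v : V, Even (G.degree v))
    (hedge : G.edgeFinset.Nonempty) (hodd : Odd G.edgeFinset.card)
    (hNc : ∃ t, HasIntervalCyclicColoring G t)
    (hchi : chromaticIndex G = G.maxDegree) :
    chromaticIndex G < wc G := by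
  obtain ⟨ht, c, hc⟩ : HasIntervalCyclicColoring G (wc G) := Nat.sInf_mem hNc
  by_contra! hlt
  have hle : G.maxDegree ≤ wc G := by
    refine G.maxDegree_le_of_forall_degree_le _ fun v => ?_
    convert HasIntervalCyclicColoring.degree_le ⟨ht, c, hc⟩ v
  have heq : wc G = G.maxDegree := by omega
  have := hconn.nonempty
  obtain ⟨v, hv⟩ := G.exists_maximal_degree_vertex
  have h2 : 2 ∣ wc G := by
    rw [heq, hv]
    exact (heven v).two_dvd
  refine Nat.not_even_iff_odd.2 hodd ?_
  convert hc.even_card_edgeFinset h2 fun v => ?_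
  convert heven v

end IntervalCyclic
end
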